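/- Let Γ denote the set of complete Llull matrices on a finite set A. The projection operator P : Γ → Γ, v ↦ v^π, is idempotent: P² = P. Its image PΓ consists exactly of the complete Llull matrices v for which there exists a strict total order ξ on A such that the margins m_{xy} = v_{xy} − v_{yx} satisfy: m_{xy} ≥ 0 whenever x precedes y in ξ, and m_{xz} = max(m_{xy}, m_{yz}) whenever x precedes y and y precedes z in ξ. -/

import Mathlib

/-! Common definitions: valued relations, indirect scores, admissible orders,
projected margins/scores, rank-like rates (Camps–Mora–Saumell CLC method). -/

variable {A : Type*} [Fintype A] [DecidableEq A]

/-- The score of a chain `x₀ :: x₁ :: ... :: xₙ`: the minimum of `v xᵢ xᵢ₊₁`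
over its links (value `1` for chains with no link, which we never use). -/
noncomputable def linkScore (v : A → A → ℝ) : List A → ℝ
  | [] => 1
  | [_] => 1
  | [a, b] => v a b
  | a :: b :: c :: l => min (v a b) (linkScore v (b :: c :: l))

/-- The indirect score `v*_{xy}`: the supremum (= maximum) of the scores of all
paths from `x` to `y` (with at least one link, consecutive elements distinct). -/
noncomputable def istar (v : A → A → ℝ) (x y : A) : ℝ :=
  sSup { s : ℝ | ∃ l : List A, List.Chain' (· ≠ ·) (x :: (l ++ [y])) ∧
      s = linkScore v (x :: (l ++ [y])) }

/-- `ξ` is a strict total order: irreflexive, transitive, total. -/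
def StrictTotal (ξ : A → A → Prop) : Prop :=
  (∀ x, ¬ ξ x x) ∧ (∀ x y z, ξ x y → ξ y z → ξ x z) ∧ (∀ x y, x ≠ y → ξ x y ∨ ξ y x)

/-- `ξ` is admissible for `v`: `v*_{xy} > v*_{yx}` implies `x` precedes `y`. -/
def Adm (v : A → A → ℝ) (ξ : A → A → Prop) : Prop :=
  ∀ x y, istar v x y > istar v y x → ξ x y

/-- Intermediate projected margin `m^σ_{xy}` (for `x` preceding `y` in `ξ`):
the infimum (= minimum) of the indirect margins `m*_{pq}` over `p ⪯ x`, `y ⪯ q`. -/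
noncomputable def msigma (v : A → A → ℝ) (ξ : A → A → Prop) (x y : A) : ℝ :=
  sInf { s : ℝ | ∃ p q, (ξ p x ∨ p = x) ∧ (ξ y q ∨ q = y) ∧
      s = istar v p q - istar v q p }

/-- `q` is the immediate successor of `p` in `ξ`. -/
def ImmSucc (ξ : A → A → Prop) (p q : A) : Prop :=
  ξ p q ∧ ∀ z, ¬ (ξ p z ∧ ξ z q)

/-- Projected margin (for `x` preceding `y` in `ξ`): the supremum (= maximum) of
`m^σ_{p p'}` over `x ⪯ p ≺ y`, `p'` the immediate successor of `p`. -/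
noncomputable def mpiAux (v : A → A → ℝ) (ξ : A → A → Prop) (x y : A) : ℝ :=
  sSup { s : ℝ | ∃ p q, (ξ x p ∨ p = x) ∧ ξ p y ∧ ImmSucc ξ p q ∧
      s = msigma v ξ p q }

open Classical in
/-- Projected margins `m^π`, extended antisymmetrically. -/
noncomputable def mpi (v : A → A → ℝ) (ξ : A → A → Prop) (x y : A) : ℝ :=
  if ξ x y then mpiAux v ξ x y else - mpiAux v ξ y x

/-- Projected scores `v^π_{xy} = (1 + m^π_{xy})/2`. -/
noncomputable def vpi (v : A → A → ℝ) (ξ : A → A → Prop) (x y : A) : ℝ :=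
  (1 + mpi v ξ x y) / 2

/-- Rank-like rate `R_x = N - ∑_{y ≠ x} v^π_{xy}`. -/
noncomputable def rlr (v : A → A → ℝ) (ξ : A → A → Prop) (x : A) : ℝ :=
  (Fintype.card A : ℝ) - ∑ y ∈ Finset.univ.erase x, vpi v ξ x y

/-- `v` is a complete Llull matrix: scores of distinct pairs lie in `[0,1]`
and satisfy `v_{xy} + v_{yx} = 1`. -/
def Llull (v : A → A → ℝ) : Prop :=
  ∀ x y : A, x ≠ y → 0 ≤ v x y ∧ v x y ≤ 1 ∧ v x y + v y x = 1

/-- The margins of `v` are nonnegative and max-additive along the order `ξ`. -/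
def MaxAdditive {A : Type*} (v : A → A → ℝ) (ξ : A → A → Prop) : Prop :=
  (∀ x y, ξ x y → 0 ≤ v x y - v y x) ∧
    ∀ x y z, ξ x y → ξ y z → v x z - v z x = max (v x y - v y x) (v y z - v z y)

section Basic

variable {A : Type*} {v : A → A → ℝ} {ξ : A → A → Prop}

lemma StrictTotal.not_symm (hξ : StrictTotal ξ) {x y : A} (h : ξ x y) : ¬ ξ y x :=
  fun h' => hξ.1 x (hξ.2.1 x y x h h')

lemma StrictTotal.ne (hξ : StrictTotal ξ) {x y : A} (h : ξ x y) : x ≠ y :=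
  fun e => hξ.1 y (e ▸ h)

lemma StrictTotal.lt_of_le_of_lt (hξ : StrictTotal ξ) {p x y : A} (h : ξ p x ∨ p = x)
    (h' : ξ x y) : ξ p y := by
  rcases h with h | rfl
  exacts [hξ.2.1 _ _ _ h h', h']

lemma StrictTotal.lt_of_lt_of_le (hξ : StrictTotal ξ) {x y q : A} (h : ξ x y)
    (h' : ξ y q ∨ q = y) : ξ x q := by
  rcases h' with h' | rfl
  exacts [hξ.2.1 _ _ _ h h', h]

lemma linkScore_cons_cons_append (v : A → A → ℝ) (x a : A) (l : List A) (y : A) :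
    linkScore v (x :: ((a :: l) ++ [y])) = min (v x a) (linkScore v (a :: (l ++ [y]))) := by
  cases l <;> rfl

lemma linkScore_le_one (hv : Llull v) {x y : A} (l : List A)
    (h : List.IsChain (· ≠ ·) (x :: (l ++ [y]))) : linkScore v (x :: (l ++ [y])) ≤ 1 := by
  cases l with
  | nil => exact (hv x y (by simpa using h)).2.1
  | cons a l =>
    rw [linkScore_cons_cons_append]
    rw [List.cons_append, List.isChain_cons_cons] at h
    exact (min_le_left _ _).trans (hv x a h.1).2.1

lemma le_istar (hv : Llull v) {x y : A} (hxy : x ≠ y) : v x y ≤ istar v x y := by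
  refine le_csSup ⟨1, ?_⟩ ⟨[], List.isChain_pair.2 hxy, rfl⟩
  rintro _ ⟨l, hl, rfl⟩
  exact linkScore_le_one hv l hl

lemma istar_le {x y : A} (hxy : x ≠ y) {c : ℝ}
    (h : ∀ l : List A, List.IsChain (· ≠ ·) (x :: (l ++ [y])) →
      linkScore v (x :: (l ++ [y])) ≤ c) : istar v x y ≤ c := by
  refine csSup_le ⟨_, [], List.isChain_pair.2 hxy, rfl⟩ ?_
  rintro _ ⟨l, hl, rfl⟩
  exact h l hl

/-- If `v` satisfies the ultrametric-type inequality, indirect scores are direct scores. -/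
lemma istar_eq_of_min_le (hv : Llull v)
    (h : ∀ x y z, x ≠ y → y ≠ z → x ≠ z → min (v x y) (v y z) ≤ v x z) {x y : A}
    (hxy : x ≠ y) : istar v x y = v x y := by
  refine le_antisymm (istar_le hxy fun l hl => ?_) (le_istar hv hxy)
  induction l generalizing x with
  | nil => exact le_rfl
  | cons a l ih =>
    rw [linkScore_cons_cons_append]
    rw [List.cons_append, List.isChain_cons_cons] at hl
    by_cases hay : a = y
    · exact hay ▸ min_le_left _ _
    · exact (min_le_min le_rfl (ih hay hl.2)).trans (h x a y hl.1 hay hxy)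

lemma MaxAdditive.min_le (hv : Llull v) (hξ : StrictTotal ξ) (h : MaxAdditive v ξ) {x y z : A}
    (hxy : x ≠ y) (hyz : y ≠ z) (hxz : x ≠ z) : min (v x y) (v y z) ≤ v x z := by
  have e₁ := (hv x y hxy).2.2
  have e₂ := (hv y z hyz).2.2
  have e₃ := (hv x z hxz).2.2
  obtain ⟨h₀, h₁⟩ := h
  rcases hξ.2.2 x y hxy with a | a <;> rcases hξ.2.2 y z hyz with b | b <;>
    rcases hξ.2.2 x z hxz with c | c <;>
    have a' := h₀ _ _ a <;> have b' := h₀ _ _ b <;> have c' := h₀ _ _ c <;>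
    grind

lemma MaxAdditive.istar_eq (hv : Llull v) (hξ : StrictTotal ξ) (h : MaxAdditive v ξ) {x y : A}
    (hxy : x ≠ y) : istar v x y = v x y :=
  istar_eq_of_min_le hv (fun _ _ _ => h.min_le hv hξ) hxy

lemma MaxAdditive.adm (hv : Llull v) (hξ : StrictTotal ξ) (h : MaxAdditive v ξ) : Adm v ξ := by
  intro x y hxy
  have hne : x ≠ y := fun e => by simp [e] at hxy
  rw [h.istar_eq hv hξ hne, h.istar_eq hv hξ hne.symm] at hxy
  rcases hξ.2.2 x y hne with c | c
  · exact c
  · linarith [h.1 _ _ c]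

/-- Max-additivity passes to every other admissible order. -/
lemma MaxAdditive.of_adm (hv : Llull v) (hξ : StrictTotal ξ) (h : MaxAdditive v ξ)
    {η : A → A → Prop} (hη : StrictTotal η) (hadm : Adm v η) : MaxAdditive v η := by
  have h₂ : ∀ x y, η x y → 0 ≤ v x y - v y x := by
    intro x y hxy
    by_contra hlt
    refine hη.not_symm hxy (hadm y x ?_)
    rw [h.istar_eq hv hξ (hη.ne hxy), h.istar_eq hv hξ (hη.ne hxy).symm]
    linarith
  refine ⟨h₂, fun x y z hxy hyz => ?_⟩
  have hxz := hη.2.1 _ _ _ hxy hyz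
  have a := h₂ _ _ hxy
  have b := h₂ _ _ hyz
  have c := h₂ _ _ hxz
  obtain ⟨h₀, h₁⟩ := h
  rcases hξ.2.2 x y (hη.ne hxy) with a₁ | a₁ <;> rcases hξ.2.2 y z (hη.ne hyz) with b₁ | b₁ <;>
    rcases hξ.2.2 x z (hη.ne hxz) with c₁ | c₁ <;>
    have a' := h₀ _ _ a₁ <;> have b' := h₀ _ _ b₁ <;> have c' := h₀ _ _ c₁ <;>
    grind

lemma MaxAdditive.mono (hξ : StrictTotal ξ) (h : MaxAdditive v ξ) {p x y q : A}
    (hpx : ξ p x ∨ p = x) (hxy : ξ x y) (hyq : ξ y q ∨ q = y) :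
    v x y - v y x ≤ v p q - v q p := by
  have h₁ : v x y - v y x ≤ v x q - v q x := by
    rcases hyq with hyq | rfl
    · exact h.2 _ _ _ hxy hyq ▸ le_max_left _ _
    · exact le_rfl
  refine h₁.trans ?_
  rcases hpx with hpx | rfl
  · exact h.2 _ _ _ hpx (hξ.lt_of_lt_of_le hxy hyq) ▸ le_max_right _ _
  · exact le_rfl

lemma ImmSucc.le_of_lt (hξ : StrictTotal ξ) {p q y : A} (h : ImmSucc ξ p q) (hpy : ξ p y) :
    ξ q y ∨ y = q := by
  by_contra! hne
  rcases hξ.2.2 q y (Ne.symm hne.2) with c | c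
  · exact hne.1 c
  · exact h.2 y ⟨hpy, c⟩

lemma MaxAdditive.msigma_eq (hv : Llull v) (hξ : StrictTotal ξ) (h : MaxAdditive v ξ) {x y : A}
    (hxy : ξ x y) : msigma v ξ x y = v x y - v y x := by
  refine IsLeast.csInf_eq ⟨⟨x, y, .inr rfl, .inr rfl, ?_⟩, ?_⟩
  · rw [h.istar_eq hv hξ (hξ.ne hxy), h.istar_eq hv hξ (hξ.ne hxy).symm]
  · rintro _ ⟨p, q, hp, hq, rfl⟩
    have hne := hξ.ne (hξ.lt_of_le_of_lt hp (hξ.lt_of_lt_of_le hxy hq))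
    rw [h.istar_eq hv hξ hne, h.istar_eq hv hξ hne.symm]
    exact h.mono hξ hp hxy hq

lemma Adm.istar_sub_nonneg (hξ : StrictTotal ξ) (hadm : Adm v ξ) {p q : A} (h : ξ p q) :
    0 ≤ istar v p q - istar v q p := by
  by_contra hlt
  exact hξ.not_symm h (hadm q p (by linarith))

lemma msigma_nonneg (hξ : StrictTotal ξ) (hadm : Adm v ξ) {x y : A} (hxy : ξ x y) :
    0 ≤ msigma v ξ x y := by
  refine Real.sInf_nonneg ?_
  rintro _ ⟨p, q, hp, hq, rfl⟩
  exact hadm.istar_sub_nonneg hξ (hξ.lt_of_le_of_lt hp (hξ.lt_of_lt_of_le hxy hq))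

lemma msigma_le_one (hv : Llull v) (hξ : StrictTotal ξ) (hadm : Adm v ξ) {x y : A}
    (hxy : ξ x y) : msigma v ξ x y ≤ 1 := by
  have hne := hξ.ne hxy
  have h₁ : msigma v ξ x y ≤ istar v x y - istar v y x := by
    refine csInf_le ⟨0, ?_⟩ ⟨x, y, .inr rfl, .inr rfl, rfl⟩
    rintro _ ⟨p, q, hp, hq, rfl⟩
    exact hadm.istar_sub_nonneg hξ (hξ.lt_of_le_of_lt hp (hξ.lt_of_lt_of_le hxy hq))
  have h₂ : istar v x y ≤ 1 := istar_le hne fun l hl => linkScore_le_one hv l hl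
  linarith [le_istar hv hne.symm, (hv y x hne.symm).1]

lemma mpiAux_nonneg (hξ : StrictTotal ξ) (hadm : Adm v ξ) (x y : A) : 0 ≤ mpiAux v ξ x y := by
  refine Real.sSup_nonneg ?_
  rintro _ ⟨p, q, -, -, hpq, rfl⟩
  exact msigma_nonneg hξ hadm hpq.1

lemma mpiAux_le_one (hv : Llull v) (hξ : StrictTotal ξ) (hadm : Adm v ξ) (x y : A) :
    mpiAux v ξ x y ≤ 1 := by
  refine Real.sSup_le ?_ zero_le_one
  rintro _ ⟨p, q, -, -, hpq, rfl⟩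
  exact msigma_le_one hv hξ hadm hpq.1

lemma msigma_le_mpiAux (hv : Llull v) (hξ : StrictTotal ξ) (hadm : Adm v ξ) {x y p q : A}
    (hxp : ξ x p ∨ p = x) (hpy : ξ p y) (hpq : ImmSucc ξ p q) :
    msigma v ξ p q ≤ mpiAux v ξ x y := by
  refine le_csSup ⟨1, ?_⟩ ⟨p, q, hxp, hpy, hpq, rfl⟩
  rintro _ ⟨p, q, -, -, hpq, rfl⟩
  exact msigma_le_one hv hξ hadm hpq.1

lemma mpiAux_eq_max (hv : Llull v) (hξ : StrictTotal ξ) (hadm : Adm v ξ) {x y z : A}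
    (hxy : ξ x y) (hyz : ξ y z) :
    mpiAux v ξ x z = max (mpiAux v ξ x y) (mpiAux v ξ y z) := by
  refine le_antisymm (Real.sSup_le ?_ (le_max_of_le_left (mpiAux_nonneg hξ hadm x y)))
    (max_le (Real.sSup_le ?_ (mpiAux_nonneg hξ hadm x z))
      (Real.sSup_le ?_ (mpiAux_nonneg hξ hadm x z)))
  · rintro _ ⟨p, q, hp, hpz, hpq, rfl⟩
    by_cases hpy : ξ p y
    · exact le_max_of_le_left (msigma_le_mpiAux hv hξ hadm hp hpy hpq)
    · refine le_max_of_le_right (msigma_le_mpiAux hv hξ hadm ?_ hpz hpq)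
      by_cases e : p = y
      · exact .inr e
      · exact .inl ((hξ.2.2 p y e).resolve_left hpy)
  · rintro _ ⟨p, q, hp, hpy, hpq, rfl⟩
    exact msigma_le_mpiAux hv hξ hadm hp (hξ.2.1 _ _ _ hpy hyz) hpq
  · rintro _ ⟨p, q, hp, hpz, hpq, rfl⟩
    exact msigma_le_mpiAux hv hξ hadm (.inl (hξ.lt_of_lt_of_le hxy hp)) hpz hpq

lemma vpi_of_lt {x y : A} (h : ξ x y) : vpi v ξ x y = (1 + mpiAux v ξ x y) / 2 := by
  simp [vpi, mpi, h]

lemma vpi_of_gt (hξ : StrictTotal ξ) {x y : A} (h : ξ x y) :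
    vpi v ξ y x = (1 - mpiAux v ξ x y) / 2 := by
  simp [vpi, mpi, hξ.not_symm h, sub_eq_add_neg]

lemma vpi_sub_vpi (hξ : StrictTotal ξ) {x y : A} (h : ξ x y) :
    vpi v ξ x y - vpi v ξ y x = mpiAux v ξ x y := by
  rw [vpi_of_lt h, vpi_of_gt hξ h]
  ring

lemma llull_vpi (hv : Llull v) (hξ : StrictTotal ξ) (hadm : Adm v ξ) : Llull (vpi v ξ) := by
  intro x y hxy
  rcases hξ.2.2 x y hxy with h | h
  · have h₀ := mpiAux_nonneg hξ hadm x y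
    have h₁ := mpiAux_le_one hv hξ hadm x y
    rw [vpi_of_lt h, vpi_of_gt hξ h]
    refine ⟨?_, ?_, ?_⟩ <;> linarith
  · have h₀ := mpiAux_nonneg hξ hadm y x
    have h₁ := mpiAux_le_one hv hξ hadm y x
    rw [vpi_of_lt h, vpi_of_gt hξ h]
    refine ⟨?_, ?_, ?_⟩ <;> linarith

lemma maxAdditive_vpi (hv : Llull v) (hξ : StrictTotal ξ) (hadm : Adm v ξ) :
    MaxAdditive (vpi v ξ) ξ := by
  refine ⟨fun x y h => ?_, fun x y z hxy hyz => ?_⟩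
  · rw [vpi_sub_vpi hξ h]
    exact mpiAux_nonneg hξ hadm x y
  · rw [vpi_sub_vpi hξ hxy, vpi_sub_vpi hξ hyz, vpi_sub_vpi hξ (hξ.2.1 _ _ _ hxy hyz)]
    exact mpiAux_eq_max hv hξ hadm hxy hyz

/-- In a finite order, every margin is attained at a pair of consecutive elements. -/
lemma MaxAdditive.exists_immSucc [Finite A] (hξ : StrictTotal ξ) (h : MaxAdditive v ξ) {x y : A}
    (hxy : ξ x y) : ∃ p q, (ξ x p ∨ p = x) ∧ ξ p y ∧ ImmSucc ξ p q ∧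
      v x y - v y x = v p q - v q p := by
  induction hn : {z | ξ x z ∧ ξ z y}.ncard using Nat.strong_induction_on generalizing x y with
  | _ n ih =>
    by_cases hs : ImmSucc ξ x y
    · exact ⟨x, y, .inr rfl, hxy, hs, rfl⟩
    obtain ⟨z, hxz, hzy⟩ : ∃ z, ξ x z ∧ ξ z y := by
      by_contra hno
      exact hs ⟨hxy, fun z hz => hno ⟨z, hz⟩⟩
    rw [h.2 _ _ _ hxz hzy]
    rcases max_choice (v x z - v z x) (v z y - v y z) with e | e <;> rw [e]
    · have hlt : {w | ξ x w ∧ ξ w z}.ncard < {w | ξ x w ∧ ξ w y}.ncard :=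
        Set.ncard_lt_ncard ⟨fun w hw => ⟨hw.1, hξ.2.1 _ _ _ hw.2 hzy⟩,
          fun hsub => hξ.1 z (hsub ⟨hxz, hzy⟩).2⟩ (Set.toFinite _)
      obtain ⟨p, q, hp, hpz, hpq, e'⟩ := ih _ (hn ▸ hlt) hxz rfl
      exact ⟨p, q, hp, hξ.2.1 _ _ _ hpz hzy, hpq, e'⟩
    · have hlt : {w | ξ z w ∧ ξ w y}.ncard < {w | ξ x w ∧ ξ w y}.ncard :=
        Set.ncard_lt_ncard ⟨fun w hw => ⟨hξ.2.1 _ _ _ hxz hw.1, hw.2⟩,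
          fun hsub => hξ.1 z (hsub ⟨hxz, hzy⟩).1⟩ (Set.toFinite _)
      obtain ⟨p, q, hp, hpy, hpq, e'⟩ := ih _ (hn ▸ hlt) hzy rfl
      exact ⟨p, q, .inl (hξ.lt_of_lt_of_le hxz hp), hpy, hpq, e'⟩

lemma MaxAdditive.mpiAux_eq [Finite A] (hv : Llull v) (hξ : StrictTotal ξ)
    (h : MaxAdditive v ξ) {x y : A} (hxy : ξ x y) : mpiAux v ξ x y = v x y - v y x := by
  refine IsGreatest.csSup_eq ⟨?_, ?_⟩
  · obtain ⟨p, q, hp, hpy, hpq, e⟩ := h.exists_immSucc hξ hxy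
    exact ⟨p, q, hp, hpy, hpq, by rw [h.msigma_eq hv hξ hpq.1, e]⟩
  · rintro _ ⟨p, q, hp, hpy, hpq, rfl⟩
    rw [h.msigma_eq hv hξ hpq.1]
    exact h.mono hξ (hp.imp_right Eq.symm) hpq.1 (hpq.le_of_lt hξ hpy)

/-- Max-additive matrices are fixed by the projection, whatever admissible order is used. -/
lemma MaxAdditive.vpi_eq [Finite A] (hv : Llull v) (hξ : StrictTotal ξ) (h : MaxAdditive v ξ)
    {η : A → A → Prop} (hη : StrictTotal η) (hadm : Adm v η) {x y : A} (hxy : x ≠ y) :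
    vpi v η x y = v x y := by
  have h' := h.of_adm hv hξ hη hadm
  have e := (hv x y hxy).2.2
  rcases hη.2.2 x y hxy with c | c
  · rw [vpi_of_lt c, h'.mpiAux_eq hv hη c]
    linarith
  · rw [vpi_of_gt hη c, h'.mpiAux_eq hv hη c]
    linarith

lemma MaxAdditive.congr (hξ : StrictTotal ξ) {w : A → A → ℝ} (h : MaxAdditive w ξ)
    (hvw : ∀ x y, x ≠ y → v x y = w x y) : MaxAdditive v ξ := by
  have hm : ∀ x y, ξ x y → v x y - v y x = w x y - w y x := fun x y c => by
    rw [hvw x y (hξ.ne c), hvw y x (hξ.ne c).symm]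
  refine ⟨fun x y c => hm x y c ▸ h.1 x y c, fun x y z hxy hyz => ?_⟩
  rw [hm x y hxy, hm y z hyz, hm x z (hξ.2.1 _ _ _ hxy hyz)]
  exact h.2 x y z hxy hyz

end Basic

/-- The projection `P : Γ → Γ`, `v ↦ v^π`, is idempotent, and its
image consists exactly of the complete Llull matrices whose margins satisfy,
for some strict total order `ξ`: `m_{xy} ≥ 0` whenever `x ≺ y`, and
`m_{xz} = max (m_{xy}, m_{yz})` whenever `x ≺ y ≺ z`. -/
theorem stmt8 {A : Type*} [Fintype A] [DecidableEq A] (v : A → A → ℝ)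
    (hv : Llull v) :
    (∀ ξ : A → A → Prop, StrictTotal ξ → Adm v ξ →
      ∀ η : A → A → Prop, StrictTotal η → Adm (vpi v ξ) η →
        ∀ x y : A, x ≠ y → vpi (vpi v ξ) η x y = vpi v ξ x y) ∧
    ((∃ ξ : A → A → Prop, StrictTotal ξ ∧
        (∀ x y, ξ x y → 0 ≤ v x y - v y x) ∧
        (∀ x y z, ξ x y → ξ y z →
          v x z - v z x = max (v x y - v y x) (v y z - v z y))) ↔
      (∃ w : A → A → ℝ, Llull w ∧ ∃ ζ : A → A → Prop, StrictTotal ζ ∧ Adm w ζ ∧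
        ∀ x y : A, x ≠ y → v x y = vpi w ζ x y)) := by
  constructor
  · intro ξ hξ hadm η hη hadm' x y hxy
    exact (maxAdditive_vpi hv hξ hadm).vpi_eq (llull_vpi hv hξ hadm) hξ hη hadm' hxy
  · constructor
    · rintro ⟨ξ, hξ, h⟩
      have h : MaxAdditive v ξ := h
      exact ⟨v, hv, ξ, hξ, h.adm hv hξ, fun x y hxy =>
        (h.vpi_eq hv hξ hξ (h.adm hv hξ) hxy).symm⟩
    · rintro ⟨w, hw, ζ, hζ, hadm, hvw⟩
      exact ⟨ζ, hζ, (maxAdditive_vpi hw hζ hadm).congr hζ hvw⟩
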